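/- Let G be a finite simple graph on vertex set V and let A ⊆ V with |A| = k be such that V ∖ A induces a clique in G. Then the number of distinct nice interval supergraphs of G with respect to the clique V ∖ A is at most (2k + 1) · (2k)!. -/

import Mathlib

/-- A finite simple graph `H` is an interval graph if there is an assignment of
real intervals `[l v, r v]` (with `l v ≤ r v`) to the vertices such that distinct
vertices are adjacent iff their intervals intersect. -/
def IsIntervalGraph {V : Type*} (H : SimpleGraph V) : Prop :=
  ∃ l r : V → ℝ, (∀ v, l v ≤ r v) ∧
    ∀ u v : V, u ≠ v →
      (H.Adj u v ↔ (Set.Icc (l u) (r u) ∩ Set.Icc (l v) (r v)).Nonempty)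

/-- The boxicity of `G` : the least `k` such that `G` is the edge-intersection of
`k` interval graphs on the same vertex set. -/
noncomputable def boxicity {V : Type*} (G : SimpleGraph V) : ℕ :=
  sInf {k | ∃ I : Fin k → SimpleGraph V,
    (∀ i, IsIntervalGraph (I i)) ∧ ∀ u v : V, G.Adj u v ↔ ∀ i, (I i).Adj u v}

/-- `H` is a nice interval supergraph of `G` with respect to a clique `S` of `G` if
`H` is an interval supergraph of `G` having an interval representation `v ↦ [l v, r v]`
and a point `p` such that `p` lies in the interval of every `v ∈ S`, and for every
`v ∈ S`, `l v = min ({p} ∪ {r u : u ∈ N_G(v) \ S})` and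
`r v = max ({p} ∪ {l u : u ∈ N_G(v) \ S})`. -/
def IsNiceIntervalSupergraph {V : Type*} (G : SimpleGraph V) (S : Set V)
    (H : SimpleGraph V) : Prop :=
  G ≤ H ∧ ∃ l r : V → ℝ, (∀ v, l v ≤ r v) ∧
    (∀ u v : V, u ≠ v →
      (H.Adj u v ↔ (Set.Icc (l u) (r u) ∩ Set.Icc (l v) (r v)).Nonempty)) ∧
    ∃ p : ℝ,
      (∀ v ∈ S, p ∈ Set.Icc (l v) (r v)) ∧
      ∀ v ∈ S,
        IsLeast ({p} ∪ (r '' (G.neighborSet v \ S))) (l v) ∧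
        IsGreatest ({p} ∪ (l '' (G.neighborSet v \ S))) (r v)

theorem exists_equiv_fin_lt_iff {ι β : Type*} [Fintype ι] [LinearOrder β] {f : ι → β}
    (hf : Function.Injective f) :
    ∃ e : ι ≃ Fin (Fintype.card ι), ∀ i j, e i < e j ↔ f i < f j := by
  let _ : LinearOrder ι := LinearOrder.lift' f hf
  let e := (Fintype.orderIsoFinOfCardEq ι rfl).symm
  exact ⟨e.toEquiv, fun i j => e.lt_iff_lt⟩

theorem icc_inter_icc_nonempty_iff {a b c d : ℝ} (hab : a ≤ b) (hcd : c ≤ d) :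
    (Set.Icc a b ∩ Set.Icc c d).Nonempty ↔ a ≤ d ∧ c ≤ b := by
  rw [Set.Icc_inter_Icc, Set.nonempty_Icc]
  simp [hab, hcd, and_comm]

section EndpointOrder

variable {α : Type*} [Fintype α]

/-- A key sorting the endpoints of a family of intervals together with the point `p`; at equal
values, left endpoints precede `p`, which precedes right endpoints. -/
noncomputable def endpointKey (l r : α → ℝ) (p : ℝ) : Option (α × Bool) → ℝ ×ₗ ℕ
  | none => toLex (p, Fintype.card α)
  | some (v, false) => toLex (l v, Fintype.equivFin α v)
  | some (v, true) => toLex (r v, Fintype.card α + 1 + Fintype.equivFin α v)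

/-- `f` takes the value `f v` already at an element preceding `v` in the fixed enumeration. -/
def IsRepeated (f : α → ℝ) (v : α) : Prop :=
  ∃ w, f w = f v ∧ Fintype.equivFin α w < Fintype.equivFin α v

/-- The interval of `v` lies strictly on one side of `p`, and its endpoint nearest to `p`
repeats an earlier one. -/
def IsTied (l r : α → ℝ) (p : ℝ) (v : α) : Prop :=
  r v < p ∧ IsRepeated r v ∨ p < l v ∧ IsRepeated l v

open Classical in
/-- The relabelling that exchanges the two endpoints of every tied interval. -/
noncomputable def exchangeTied (l r : α → ℝ) (p : ℝ) : Option (α × Bool) → Option (α × Bool)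
  | none => none
  | some (v, b) => some (v, xor b (decide (IsTied l r p v)))

theorem exchangeTied_involutive (l r : α → ℝ) (p : ℝ) :
    Function.Involutive (exchangeTied l r p) := by
  rintro (_ | ⟨v, b⟩) <;> simp [exchangeTied]

theorem endpointKey_injective (l r : α → ℝ) (p : ℝ) :
    Function.Injective (endpointKey l r p) := by
  rintro (_ | ⟨u, _ | _⟩) (_ | ⟨v, _ | _⟩) h
  · rfl
  all_goals
    simp only [endpointKey, toLex_inj, Prod.mk.injEq] at h
    have := h.2
  · have := (Fintype.equivFin α v).2; omega
  · omega
  · have := (Fintype.equivFin α u).2; omega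
  · rw [(Fintype.equivFin α).injective (Fin.ext this)]
  · have := (Fintype.equivFin α u).2; omega
  · omega
  · have := (Fintype.equivFin α v).2; omega
  · rw [(Fintype.equivFin α).injective (Fin.ext (Nat.add_left_cancel this))]

theorem endpointKey_left_lt_right {l r : α → ℝ} {p : ℝ} (u v : α) :
    endpointKey l r p (some (u, false)) < endpointKey l r p (some (v, true)) ↔ l u ≤ r v := by
  have := (Fintype.equivFin α u).2
  simp only [endpointKey, Prod.Lex.toLex_lt_toLex, le_iff_lt_or_eq]
  exact or_congr_right (and_iff_left (by omega))

theorem endpointKey_none_lt_right {l r : α → ℝ} {p : ℝ} (v : α) :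
    endpointKey l r p none < endpointKey l r p (some (v, true)) ↔ p ≤ r v := by
  simp only [endpointKey, Prod.Lex.toLex_lt_toLex, le_iff_lt_or_eq]
  exact or_congr_right (and_iff_left (by omega))

theorem endpointKey_left_lt_none {l r : α → ℝ} {p : ℝ} (v : α) :
    endpointKey l r p (some (v, false)) < endpointKey l r p none ↔ l v ≤ p := by
  have := (Fintype.equivFin α v).2
  simp only [endpointKey, Prod.Lex.toLex_lt_toLex, le_iff_lt_or_eq]
  exact or_congr_right (and_iff_left (by omega))

theorem endpointKey_lt_same_side {l r : α → ℝ} {p : ℝ} (b : Bool) (u v : α) :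
    endpointKey l r p (some (u, b)) < endpointKey l r p (some (v, b)) ↔
      cond b r l u < cond b r l v ∨ cond b r l u = cond b r l v ∧
        Fintype.equivFin α u < Fintype.equivFin α v := by
  cases b <;> simp [endpointKey, Prod.Lex.toLex_lt_toLex]

/-- Comparison of values is recovered from the tie-broken order and the repetition flags. -/
theorem le_iff_of_isRepeated_iff {l r : α → ℝ} {p : ℝ} (b : Bool) (s : α → Prop) (w v : α)
    (hs : ∀ u, cond b r l u = cond b r l w → (s u ↔ IsRepeated (cond b r l) u)) :
    cond b r l w ≤ cond b r l v ↔
      ∀ u, endpointKey l r p (some (v, b)) < endpointKey l r p (some (u, b)) →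
        ¬ endpointKey l r p (some (w, b)) < endpointKey l r p (some (u, b)) → s u := by
  generalize hf : cond b r l = f at hs ⊢
  simp only [endpointKey_lt_same_side, hf]
  constructor
  · intro h u hvu hwu
    push Not at hwu
    have huw : f u = f w := by
      rcases hvu with h1 | ⟨h1, -⟩ <;> linarith [hwu.1]
    have hvu' : f v = f u := by
      rcases hvu with h1 | ⟨h1, -⟩
      · linarith
      · exact h1
    rw [hs u huw]
    refine ⟨v, hvu', ?_⟩
    rcases hvu with h1 | ⟨-, h1⟩
    · linarith
    · exact h1
  · intro h
    by_contra! hlt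
    obtain ⟨u, hu, hmin⟩ := (Set.toFinite {u | f u = f w}).exists_minimalFor
      (Fintype.equivFin α) _ ⟨w, rfl⟩
    rw [Set.mem_ofPred_eq] at hu
    have hle : ∀ x, f x = f w → Fintype.equivFin α u ≤ Fintype.equivFin α x := fun x hx => by
      rcases le_total (Fintype.equivFin α u) (Fintype.equivFin α x) with h1 | h1
      · exact h1
      · exact hmin hx h1
    obtain ⟨x, hx, hxu⟩ := (hs u hu).1 (h u (Or.inl (hu ▸ hlt)) (by
      push Not
      exact ⟨hu.le, fun _ => hle w rfl⟩))
    exact absurd (hle x (hx.trans hu)) (not_le.2 hxu)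

/-- Two families of intervals whose relabelled endpoints are ordered in the same way. -/
def SameEndpointOrder (l r : α → ℝ) (p : ℝ) (l' r' : α → ℝ) (p' : ℝ) : Prop :=
  ∀ i j, endpointKey l r p (exchangeTied l r p i) < endpointKey l r p (exchangeTied l r p j) ↔
    endpointKey l' r' p' (exchangeTied l' r' p' i) <
      endpointKey l' r' p' (exchangeTied l' r' p' j)

variable {l r l' r' : α → ℝ} {p p' : ℝ}

theorem isTied_iff_exchangeTied_lt (hlr : ∀ v, l v ≤ r v) (v : α) :
    IsTied l r p v ↔ endpointKey l r p (exchangeTied l r p (some (v, true))) <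
      endpointKey l r p (exchangeTied l r p (some (v, false))) := by
  have h := (endpointKey_left_lt_right (p := p) v v).2 (hlr v)
  by_cases ht : IsTied l r p v
  · simpa [exchangeTied, ht] using h
  · simpa [exchangeTied, ht] using h.le

theorem SameEndpointOrder.isTied_iff (h : SameEndpointOrder l r p l' r' p')
    (hlr : ∀ v, l v ≤ r v) (hlr' : ∀ v, l' v ≤ r' v) (v : α) :
    IsTied l r p v ↔ IsTied l' r' p' v := by
  rw [isTied_iff_exchangeTied_lt hlr, isTied_iff_exchangeTied_lt hlr', h]

theorem SameEndpointOrder.endpointKey_lt_iff (h : SameEndpointOrder l r p l' r' p')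
    (hlr : ∀ v, l v ≤ r v) (hlr' : ∀ v, l' v ≤ r' v) (i j : Option (α × Bool)) :
    endpointKey l r p i < endpointKey l r p j ↔
      endpointKey l' r' p' i < endpointKey l' r' p' j := by
  have he : exchangeTied l r p = exchangeTied l' r' p' := by
    funext i
    rcases i with _ | ⟨v, b⟩
    · rfl
    · simp [exchangeTied, h.isTied_iff hlr hlr' v]
  have := h (exchangeTied l r p i) (exchangeTied l r p j)
  rwa [exchangeTied_involutive, exchangeTied_involutive, he, exchangeTied_involutive,
    exchangeTied_involutive] at this

theorem isTied_iff_isRepeated_right (hlr : ∀ v, l v ≤ r v) {v : α} (hv : r v < p) :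
    IsTied l r p v ↔ IsRepeated r v := by
  have : ¬ p < l v := by linarith [hlr v]
  simp [IsTied, hv, this]

theorem isTied_iff_isRepeated_left (hlr : ∀ v, l v ≤ r v) {v : α} (hv : p < l v) :
    IsTied l r p v ↔ IsRepeated l v := by
  have : ¬ r v < p := by linarith [hlr v]
  simp [IsTied, hv, this]

theorem SameEndpointOrder.left_le_right_iff (h : SameEndpointOrder l r p l' r' p')
    (hlr : ∀ v, l v ≤ r v) (hlr' : ∀ v, l' v ≤ r' v) (u v : α) :
    l u ≤ r v ↔ l' u ≤ r' v := by
  rw [← endpointKey_left_lt_right (p := p), h.endpointKey_lt_iff hlr hlr',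
    endpointKey_left_lt_right]

theorem SameEndpointOrder.point_le_right_iff (h : SameEndpointOrder l r p l' r' p')
    (hlr : ∀ v, l v ≤ r v) (hlr' : ∀ v, l' v ≤ r' v) (v : α) :
    p ≤ r v ↔ p' ≤ r' v := by
  rw [← endpointKey_none_lt_right (l := l), h.endpointKey_lt_iff hlr hlr',
    endpointKey_none_lt_right]

theorem SameEndpointOrder.left_le_point_iff (h : SameEndpointOrder l r p l' r' p')
    (hlr : ∀ v, l v ≤ r v) (hlr' : ∀ v, l' v ≤ r' v) (v : α) :
    l v ≤ p ↔ l' v ≤ p' := by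
  rw [← endpointKey_left_lt_none (r := r), h.endpointKey_lt_iff hlr hlr',
    endpointKey_left_lt_none]

theorem SameEndpointOrder.right_le_right_iff (h : SameEndpointOrder l r p l' r' p')
    (hlr : ∀ v, l v ≤ r v) (hlr' : ∀ v, l' v ≤ r' v) {w v : α} (hw : r w < p) :
    r w ≤ r v ↔ r' w ≤ r' v := by
  have hw' : r' w < p' := by
    rwa [← not_le, ← h.point_le_right_iff hlr hlr', not_le]
  have h1 := le_iff_of_isRepeated_iff (l := l) (r := r) (p := p) true (IsTied l r p) w v
    fun u (hu : r u = r w) => isTied_iff_isRepeated_right hlr (hu ▸ hw)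
  have h2 := le_iff_of_isRepeated_iff (l := l') (r := r') (p := p') true (IsTied l' r' p') w v
    fun u (hu : r' u = r' w) => isTied_iff_isRepeated_right hlr' (hu ▸ hw')
  simp only [h.endpointKey_lt_iff hlr hlr', h.isTied_iff hlr hlr'] at h1
  exact h1.trans h2.symm

theorem SameEndpointOrder.left_le_left_iff (h : SameEndpointOrder l r p l' r' p')
    (hlr : ∀ v, l v ≤ r v) (hlr' : ∀ v, l' v ≤ r' v) {w v : α} (hw : p < l w) :
    l w ≤ l v ↔ l' w ≤ l' v := by
  have hw' : p' < l' w := by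
    rwa [← not_le, ← h.left_le_point_iff hlr hlr', not_le]
  have h1 := le_iff_of_isRepeated_iff (l := l) (r := r) (p := p) false (IsTied l r p) w v
    fun u (hu : l u = l w) => isTied_iff_isRepeated_left hlr (hu ▸ hw)
  have h2 := le_iff_of_isRepeated_iff (l := l') (r := r') (p := p') false (IsTied l' r' p') w v
    fun u (hu : l' u = l' w) => isTied_iff_isRepeated_left hlr' (hu ▸ hw')
  simp only [h.endpointKey_lt_iff hlr hlr', h.isTied_iff hlr hlr'] at h1
  exact h1.trans h2.symm

theorem SameEndpointOrder.exists_right_le_iff (h : SameEndpointOrder l r p l' r' p')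
    (hlr : ∀ v, l v ≤ r v) (hlr' : ∀ v, l' v ≤ r' v) (N : α → Prop) (v : α) :
    (p ≤ r v ∨ ∃ w, N w ∧ r w ≤ r v) ↔ (p' ≤ r' v ∨ ∃ w, N w ∧ r' w ≤ r' v) := by
  by_cases hv : p ≤ r v
  · simp [hv, (h.point_le_right_iff hlr hlr' v).1 hv]
  · have hv' : ¬ p' ≤ r' v := by rwa [← h.point_le_right_iff hlr hlr']
    simp only [hv, hv', false_or]
    refine exists_congr fun w => and_congr_right fun _ => ?_
    by_cases hw : p ≤ r w
    · have hw' := (h.point_le_right_iff hlr hlr' w).1 hw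
      exact iff_of_false (fun h => hv (hw.trans h)) (fun h => hv' (hw'.trans h))
    · exact h.right_le_right_iff hlr hlr' (not_le.1 hw)

theorem SameEndpointOrder.exists_le_left_iff (h : SameEndpointOrder l r p l' r' p')
    (hlr : ∀ v, l v ≤ r v) (hlr' : ∀ v, l' v ≤ r' v) (N : α → Prop) (v : α) :
    (l v ≤ p ∨ ∃ w, N w ∧ l v ≤ l w) ↔ (l' v ≤ p' ∨ ∃ w, N w ∧ l' v ≤ l' w) := by
  by_cases hv : l v ≤ p
  · simp [hv, (h.left_le_point_iff hlr hlr' v).1 hv]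
  · have hv' : ¬ l' v ≤ p' := by rwa [← h.left_le_point_iff hlr hlr']
    simp only [hv, hv', false_or]
    exact exists_congr fun w => and_congr_right fun _ =>
      h.left_le_left_iff hlr hlr' (not_le.1 hv)

end EndpointOrder

section NiceRepresentation

variable {V : Type*} {G H H' : SimpleGraph V} {A : Set V} {l r l' r' : V → ℝ} {p p' : ℝ}

/-- `l`, `r` and `p` witness that `H` is a nice interval supergraph of `G` with respect to the
complement of `A`. -/
structure IsNiceRepresentation (G : SimpleGraph V) (A : Set V) (H : SimpleGraph V)
    (l r : V → ℝ) (p : ℝ) : Prop where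
  le : ∀ v, l v ≤ r v
  adj_iff : ∀ u v, u ≠ v → (H.Adj u v ↔ l u ≤ r v ∧ l v ≤ r u)
  mem : ∀ v ∉ A, l v ≤ p ∧ p ≤ r v
  left_le_iff : ∀ u ∉ A, ∀ x,
    l u ≤ x ↔ p ≤ x ∨ ∃ w : A, G.Adj u w ∧ r w ≤ x
  le_right_iff : ∀ u ∉ A, ∀ x,
    x ≤ r u ↔ x ≤ p ∨ ∃ w : A, G.Adj u w ∧ x ≤ l w

theorem IsNiceIntervalSupergraph.exists_isNiceRepresentation
    (h : IsNiceIntervalSupergraph G Aᶜ H) : ∃ l r p, IsNiceRepresentation G A H l r p := by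
  obtain ⟨-, l, r, hlr, hadj, p, hp, hlg⟩ := h
  refine ⟨l, r, p, hlr, fun u v huv => ?_, fun v hv => hp v hv, fun u hu x => ?_,
    fun u hu x => ?_⟩
  · rw [hadj u v huv, icc_inter_icc_nonempty_iff (hlr u) (hlr v)]
  · obtain ⟨hmem, hlow⟩ := (hlg u hu).1
    constructor
    · intro hx
      rcases hmem with hmem | ⟨w, ⟨huw, hw⟩, hmem⟩
      · exact Or.inl (hmem ▸ hx)
      · exact Or.inr ⟨⟨w, not_not.1 hw⟩, huw, hmem.trans_le hx⟩
    · rintro (hx | ⟨w, huw, hx⟩)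
      · exact (hlow (Or.inl rfl)).trans hx
      · exact (hlow (Or.inr ⟨w, ⟨huw, fun hw => hw w.2⟩, rfl⟩)).trans hx
  · obtain ⟨hmem, hup⟩ := (hlg u hu).2
    constructor
    · intro hx
      rcases hmem with hmem | ⟨w, ⟨huw, hw⟩, hmem⟩
      · exact Or.inl (hmem ▸ hx)
      · exact Or.inr ⟨⟨w, not_not.1 hw⟩, huw, hx.trans_eq hmem.symm⟩
    · rintro (hx | ⟨w, huw, hx⟩)
      · exact hx.trans (hup (Or.inl rfl))
      · exact hx.trans (hup (Or.inr ⟨w, ⟨huw, fun hw => hw w.2⟩, rfl⟩))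

theorem IsNiceRepresentation.eq_of_sameEndpointOrder [Fintype A]
    (h : IsNiceRepresentation G A H l r p) (h' : IsNiceRepresentation G A H' l' r' p')
    (ho : SameEndpointOrder (fun v : A => l v) (fun v : A => r v) p
      (fun v : A => l' v) (fun v : A => r' v) p') : H = H' := by
  have hlr : ∀ v : A, l v ≤ r v := fun v => h.le v
  have hlr' : ∀ v : A, l' v ≤ r' v := fun v => h'.le v
  have key : ∀ u ∉ A, ∀ v ∈ A, (l u ≤ r v ∧ l v ≤ r u ↔ l' u ≤ r' v ∧ l' v ≤ r' u) := by
    intro u hu v hv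
    rw [h.left_le_iff u hu, h.le_right_iff u hu, h'.left_le_iff u hu, h'.le_right_iff u hu]
    exact and_congr (ho.exists_right_le_iff hlr hlr' (fun w => G.Adj u w) ⟨v, hv⟩)
      (ho.exists_le_left_iff hlr hlr' (fun w => G.Adj u w) ⟨v, hv⟩)
  ext u v
  rcases eq_or_ne u v with rfl | huv
  · simp
  rw [h.adj_iff u v huv, h'.adj_iff u v huv]
  by_cases hu : u ∈ A <;> by_cases hv : v ∈ A
  · exact and_congr (ho.left_le_right_iff hlr hlr' ⟨u, hu⟩ ⟨v, hv⟩)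
      (ho.left_le_right_iff hlr hlr' ⟨v, hv⟩ ⟨u, hu⟩)
  · rw [and_comm, key v hv u hu, and_comm]
  · exact key u hu v hv
  · exact iff_of_true ⟨(h.mem u hu).1.trans (h.mem v hv).2, (h.mem v hv).1.trans (h.mem u hu).2⟩
      ⟨(h'.mem u hu).1.trans (h'.mem v hv).2, (h'.mem v hv).1.trans (h'.mem u hu).2⟩

end NiceRepresentation

/-- If `|A| = k` and `V \ A` induces a clique in `G`, then the number of distinct nice
interval supergraphs of `G` with respect to the clique `V \ A` is at most
`(2k + 1) · (2k)!`. -/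
theorem card_niceIntervalSupergraphs_le
    {V : Type*} [Fintype V] (G : SimpleGraph V) (A : Set V) (k : ℕ)
    (hk : A.ncard = k) (hclique : G.IsClique Aᶜ) :
    Nat.card {H : SimpleGraph V // IsNiceIntervalSupergraph G Aᶜ H} ≤
      (2 * k + 1) * Nat.factorial (2 * k) := by
  classical
  have hcard : Fintype.card (Option (A × Bool)) = 2 * k + 1 := by
    rw [Fintype.card_option, Fintype.card_prod, Fintype.card_bool, ← Nat.card_eq_fintype_card,
      Nat.card_coe_set_eq, hk, mul_comm]
  choose l r p hrep using fun H : {H : SimpleGraph V // IsNiceIntervalSupergraph G Aᶜ H} =>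
    H.2.exists_isNiceRepresentation
  choose e he using fun H => exists_equiv_fin_lt_iff
    ((endpointKey_injective (fun v : A => l H v) (fun v : A => r H v) (p H)).comp
      (exchangeTied_involutive (fun v : A => l H v) (fun v : A => r H v) (p H)).injective)
  have hinj : Function.Injective e := fun H H' hHH' =>
    Subtype.ext ((hrep H).eq_of_sameEndpointOrder (hrep H') fun i j =>
      (he H i j).symm.trans (hHH' ▸ he H' i j))
  calc _ ≤ Nat.card (Option (A × Bool) ≃ Fin (Fintype.card (Option (A × Bool)))) :=
        Nat.card_le_card_of_injective e hinj
    _ = (2 * k + 1) * Nat.factorial (2 * k) := by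
        rw [Nat.card_eq_fintype_card, Fintype.card_equiv (Fintype.equivFin _), hcard,
          Nat.factorial_succ]
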